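/- arXiv:1604.04760 — 5 statements merged into one kernel-verified Lean document; each statement's English description precedes it below -/
import Mathlib

section
/- Let p be a positive integer, let t be a real number with 0 ≤ t ≤ 2/p, let c be a real number, and let u : ℤ → ℝ. Assume: (i) for all integers n ≥ r with gcd(n,p) = 1 and gcd(r,p) = 1, one has 0 ≤ (u(n) + (p−1)·n·t/2) − (u(r) + (p−1)·r·t/2) ≤ (p−1)·t; and (ii) for every integer r, c − (p·r+2)·(p−1)·t/2 ≤ u(p·r+1) ≤ c − p·r·(p−1)·t/2. Then for every integer q with gcd(q,p) = 1, u(q) ≥ c − (p−1)·(q+1)·t/2. -/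
/-- Abstract Van Cott bootstrapping argument (lower bound), Section 3.2. -/
theorem stmt2 (p : ℕ) (hp : 0 < p) (t : ℝ) (ht0 : 0 ≤ t) (ht2 : t ≤ 2 / p)
    (c : ℝ) (u : ℤ → ℝ)
    (h1 : ∀ n r : ℤ, r ≤ n → Int.gcd n p = 1 → Int.gcd r p = 1 →
      0 ≤ (u n + (p - 1) * n * t / 2) - (u r + (p - 1) * r * t / 2) ∧
      (u n + (p - 1) * n * t / 2) - (u r + (p - 1) * r * t / 2) ≤ (p - 1) * t)
    (h2 : ∀ r : ℤ, c - (p * r + 2) * (p - 1) * t / 2 ≤ u (p * r + 1) ∧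
      u (p * r + 1) ≤ c - p * r * (p - 1) * t / 2) :
    ∀ q : ℤ, Int.gcd q p = 1 → u q ≥ c - (p - 1) * (q + 1) * t / 2 := by
  intro q hq
  have hle : (p : ℤ) * ((q - 1) / p) + 1 ≤ q := by
    have := Int.mul_ediv_self_le (x := q - 1) (k := (p : ℤ)) (by omega)
    omega
  have hgcd : Int.gcd ((p : ℤ) * ((q - 1) / p) + 1) p = 1 := by
    rw [← Int.isCoprime_iff_gcd_eq_one]
    exact ⟨1, -((q - 1) / p), by ring⟩
  have hmono := (h1 q _ hle hq hgcd).1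
  have hlower := (h2 ((q - 1) / p)).1
  push_cast at hmono
  linarith
end

section
/- Let p be a positive integer, let t be a real number with 0 ≤ t ≤ 2/p, let c be a real number, and let u : ℤ → ℝ. Assume: (i) for all integers n ≥ r with gcd(n,p) = 1 and gcd(r,p) = 1, one has 0 ≤ (u(n) + (p−1)·n·t/2) − (u(r) + (p−1)·r·t/2) ≤ (p−1)·t; and (ii) for every integer r, c − (p·r+2)·(p−1)·t/2 ≤ u(p·r+1) ≤ c − p·r·(p−1)·t/2. Then for every integer q with gcd(q,p) = 1, u(q) ≤ c − (p−1)·(q−1)·t/2. -/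
/-- Abstract Van Cott bootstrapping argument (upper bound), Section 3.2. -/
theorem stmt3 (p : ℕ) (hp : 0 < p) (t : ℝ) (ht0 : 0 ≤ t) (ht2 : t ≤ 2 / p)
    (c : ℝ) (u : ℤ → ℝ)
    (h1 : ∀ n r : ℤ, r ≤ n → Int.gcd n p = 1 → Int.gcd r p = 1 →
      0 ≤ (u n + (p - 1) * n * t / 2) - (u r + (p - 1) * r * t / 2) ∧
      (u n + (p - 1) * n * t / 2) - (u r + (p - 1) * r * t / 2) ≤ (p - 1) * t)
    (h2 : ∀ r : ℤ, c - (p * r + 2) * (p - 1) * t / 2 ≤ u (p * r + 1) ∧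
      u (p * r + 1) ≤ c - p * r * (p - 1) * t / 2) :
    ∀ q : ℤ, Int.gcd q p = 1 → u q ≤ c - (p - 1) * (q - 1) * t / 2 := by
  intro q hq
  have hp' : (1 : ℤ) ≤ p := by exact_mod_cast hp
  have hle : q ≤ p * |q| + 1 := by nlinarith [le_abs_self q, abs_nonneg q]
  have hcop : Int.gcd (p * |q| + 1) p = 1 :=
    Int.isCoprime_iff_gcd_eq_one.mp ⟨1, -|q|, by ring⟩
  have hmono := (h1 _ q hle hcop hq).1
  have hupper := (h2 |q|).2
  push_cast at hmono hupper
  linarith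
end

section
/- Let i and j be integers and let τ and g be real numbers with τ ≥ 0, |i − j| ≤ g, g + τ > 0, and i − j + τ ≠ 0. Set ξ = 2i/(i − j + τ). If 0 < ξ < 4/(g + τ), then |i| = 1. -/
/-- Arithmetic core of Lemma 4.3: if `ξ = 2i/(i - j + τ)` satisfies
`0 < ξ < 4/(g + τ)` where `|i - j| ≤ g` and `τ ≥ 0`, then `|i| = 1`. -/
theorem stmt7 (i j : ℤ) (τ g : ℝ) (hτ : 0 ≤ τ)
    (hgen : |(i : ℝ) - j| ≤ g) (hgτ : 0 < g + τ) (hne : (i : ℝ) - j + τ ≠ 0)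
    (ξ : ℝ) (hξ : ξ = 2 * i / ((i : ℝ) - j + τ))
    (h0 : 0 < ξ) (h4 : ξ < 4 / (g + τ)) :
    |i| = 1 := by
  have hD : |(i : ℝ) - j + τ| ≤ g + τ :=
    (abs_add_le _ _).trans (by rw [abs_of_nonneg hτ]; gcongr)
  have hi : ξ * ((i : ℝ) - j + τ) = 2 * i := by rw [hξ, div_mul_cancel₀ _ hne]
  have hlt : 2 * |(i : ℝ)| < 4 := calc
    2 * |(i : ℝ)| = ξ * |(i : ℝ) - j + τ| := by
      rw [← abs_of_pos h0, ← abs_mul, hi, abs_mul, abs_two]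
    _ ≤ ξ * (g + τ) := by gcongr
    _ < 4 := (lt_div_iff₀ hgτ).1 h4
  have hi_ne : i ≠ 0 := by
    rintro rfl
    simp [hξ] at h0
  have hi_lt : |i| < 2 := by
    have : |(i : ℝ)| < 2 := by linarith
    exact_mod_cast this
  have hi_pos : 0 < |i| := abs_pos.2 hi_ne
  omega
end

section
/- Let ξ : ℕ → ℝ be a strictly decreasing sequence of positive real numbers (i.e., ξ m < ξ n whenever m > n), and let f : ℕ → (ℝ → ℝ) be a family of functions such that for every n: (a) there exists a real number a with f n (t) = a·t for all t ∈ [0, ξ n]; and (b) for every ε > 0 there is no real number a with f n (t) = a·t for all t ∈ [0, ξ n + ε]. Then the family (f n) is linearly independent over ℝ in the real vector space of functions from ℝ to ℝ. -/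
/-- The functions `ℝ → ℝ` that agree with some `t ↦ a * t` on `[0, c]`. -/
def linearUpTo (c : ℝ) : Submodule ℝ (ℝ → ℝ) where
  carrier := {g | ∃ a : ℝ, ∀ t : ℝ, 0 ≤ t → t ≤ c → g t = a * t}
  zero_mem' := ⟨0, fun t _ _ => by simp⟩
  add_mem' := by
    rintro g h ⟨a, ha⟩ ⟨b, hb⟩
    exact ⟨a + b, fun t h0 hc => by rw [Pi.add_apply, ha t h0 hc, hb t h0 hc, add_mul]⟩
  smul_mem' := by
    rintro r g ⟨a, ha⟩
    exact ⟨r * a, fun t h0 hc => by rw [Pi.smul_apply, ha t h0 hc, smul_eq_mul, mul_assoc]⟩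

/-- Each term of a strictly decreasing real sequence is separated from all earlier terms. -/
lemma StrictAnti.exists_gt_forall_lt_le {ξ : ℕ → ℝ} (hξ : StrictAnti ξ) (N : ℕ) :
    ∃ c, ξ N < c ∧ ∀ i < N, c ≤ ξ i := by
  cases N with
  | zero => exact ⟨ξ 0 + 1, by linarith, fun i hi => absurd hi (Nat.not_lt_zero i)⟩
  | succ k => exact ⟨ξ k, hξ k.lt_succ_self, fun i hi => hξ.antitone (Nat.le_of_lt_succ hi)⟩

/-- Abstract linear independence argument from the proof of Corollary 1.4:
functions that are linear on `[0, ξ n]` but not on any larger interval,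
with strictly decreasing first singularities `ξ n`, are linearly independent. -/
theorem stmt8 (ξ : ℕ → ℝ) (hpos : ∀ n, 0 < ξ n)
    (hanti : ∀ m n : ℕ, n < m → ξ m < ξ n)
    (f : ℕ → ℝ → ℝ)
    (hlin : ∀ n, ∃ a : ℝ, ∀ t : ℝ, 0 ≤ t → t ≤ ξ n → f n t = a * t)
    (hsing : ∀ n, ∀ ε : ℝ, 0 < ε →
      ¬ ∃ a : ℝ, ∀ t : ℝ, 0 ≤ t → t ≤ ξ n + ε → f n t = a * t) :
    LinearIndependent ℝ f := by
  classical
  have hξ : StrictAnti ξ := fun n m h => hanti m n h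
  rw [linearIndependent_iff']
  intro s g hsum
  by_contra! hne
  obtain ⟨j, hj, hgj⟩ := hne
  obtain ⟨N, hN, hmax⟩ := (s.filter (g · ≠ 0)).exists_max_image id
    ⟨j, Finset.mem_filter.2 ⟨hj, hgj⟩⟩
  obtain ⟨hNs, hgN⟩ := Finset.mem_filter.1 hN
  obtain ⟨c, hNc, hc⟩ := hξ.exists_gt_forall_lt_le N
  have hrest : ∑ i ∈ s.erase N, g i • f i ∈ linearUpTo c := by
    refine Submodule.sum_mem _ fun i hi => ?_
    obtain ⟨hiN, his⟩ := Finset.mem_erase.1 hi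
    by_cases hgi : g i = 0
    · simp [hgi]
    · have hlt : i < N := lt_of_le_of_ne (hmax i (Finset.mem_filter.2 ⟨his, hgi⟩)) hiN
      obtain ⟨a, ha⟩ := hlin i
      exact Submodule.smul_mem _ _ ⟨a, fun t h0 ht => ha t h0 (ht.trans (hc i hlt))⟩
  have hmem : g N • f N ∈ linearUpTo c := by
    rw [← Finset.add_sum_erase s _ hNs] at hsum
    rw [eq_neg_of_add_eq_zero_left hsum]
    exact Submodule.neg_mem _ hrest
  obtain ⟨a, ha⟩ := (Submodule.smul_mem_iff _ hgN).1 hmem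
  exact hsing N (c - ξ N) (sub_pos.2 hNc) ⟨a, fun t h0 ht => ha t h0 (by linarith)⟩
end

section
/- Let S ⊆ ℤ × ℤ be the finite set S = {(0,7), (7,0)} ∪ {(i, 8−i) : i ∈ ℤ, −1 ≤ i ≤ 9}. For a real number t with 0 < t < 1, there exists a point (i, j) ∈ S with (i, j) ≠ (0, 7) satisfying (j − 7)·t = (t − 2)·i (equivalently, (i,j) lies on the line through (0,7) of slope 1 − 2/t) if and only if t = 2/3. -/
/-- Combinatorial check in Section 4.1: for `0 < t < 1`, the line through `(0,7)`
of slope `1 - 2/t` contains another point of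
`S = {(0,7), (7,0)} ∪ {(i, 8-i) : -1 ≤ i ≤ 9}` iff `t = 2/3`. -/
theorem stmt10 (S : Set (ℤ × ℤ))
    (hS : S = {((0 : ℤ), (7 : ℤ)), ((7 : ℤ), (0 : ℤ))} ∪
      {q : ℤ × ℤ | ∃ i : ℤ, -1 ≤ i ∧ i ≤ 9 ∧ q = (i, 8 - i)})
    (t : ℝ) (ht0 : 0 < t) (ht1 : t < 1) :
    (∃ q ∈ S, q ≠ ((0 : ℤ), (7 : ℤ)) ∧ ((q.2 : ℝ) - 7) * t = (t - 2) * (q.1 : ℝ)) ↔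
      t = 2 / 3 := by
  subst hS
  constructor
  · rintro ⟨q, (rfl | rfl) | ⟨i, hi, -, rfl⟩, hne, h⟩
    · exact absurd rfl hne
    · norm_num at h
      linarith
    · push_cast at h
      obtain rfl | rfl | hpos : i = -1 ∨ i = 0 ∨ 1 ≤ i := by omega
      · norm_num at h
        linarith
      · norm_num at h
        linarith
      · have hpos' : (1 : ℝ) ≤ i := by exact_mod_cast hpos
        nlinarith
  · rintro rfl
    exact ⟨(-1, 9), Or.inr ⟨-1, by norm_num⟩, by norm_num, by norm_num⟩
end
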